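/- Suppose Δ ⊢ V : A is a valid typing judgment where V is a value. Then the computational denotation factors through the unit of the monad: ⟦Δ ⊢ V : A⟧^c = ⟦Δ ⊢ V : A⟧^v ; η_{⟦A⟧} : ⟦Δ⟧ → T(⟦A⟧). -/

import Mathlib

/- The call-by-value linear lambda calculus of Selinger-Valiron, with Type-valued
   subtyping and typing derivations (used to define the categorical semantics). -/

namespace QLamSem

/-- Types: A,B ::= α | A ⊸ B | A ⊗ B | ⊤ | !A -/
inductive Ty : Type where
  | tconst : ℕ → Ty
  | arrow : Ty → Ty → Ty
  | tensor : Ty → Ty → Ty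
  | unit : Ty
  | bang : Ty → Ty
deriving DecidableEq

/-- `bangN n A` is `!ⁿA`. -/
def bangN : ℕ → Ty → Ty
  | 0, A => A
  | n + 1, A => Ty.bang (bangN n A)

/-- Derivations of the subtyping relation `A <: B`. -/
inductive SubD : Ty → Ty → Type where
  | tconst (n m a : ℕ) : (m = 0 ∨ 1 ≤ n) →
      SubD (bangN n (Ty.tconst a)) (bangN m (Ty.tconst a))
  | unit (n m : ℕ) : (m = 0 ∨ 1 ≤ n) →
      SubD (bangN n Ty.unit) (bangN m Ty.unit)
  | arrow (n m : ℕ) (A A' B B' : Ty) : (m = 0 ∨ 1 ≤ n) → SubD A A' → SubD B B' →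
      SubD (bangN n (Ty.arrow A' B)) (bangN m (Ty.arrow A B'))
  | tensor (n m : ℕ) (A A' B B' : Ty) : (m = 0 ∨ 1 ≤ n) → SubD A A' → SubD B B' →
      SubD (bangN n (Ty.tensor A B)) (bangN m (Ty.tensor A' B'))

/-- The subtyping relation `A <: B`. -/
def Sub (A B : Ty) : Prop := Nonempty (SubD A B)

/-- Indexed terms (with the `let` forms as primitive constructs). -/
inductive Tm : Type where
  | var : ℕ → Ty → Tm
  | cst : ℕ → Ty → Tm
  | star : ℕ → Tm
  | lam : ℕ → ℕ → Ty → Tm → Tm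
  | app : Tm → Tm → Tm
  | pair : ℕ → Tm → Tm → Tm
  | letv : ℕ → Ty → Tm → Tm → Tm
  | letPair : ℕ → ℕ → Ty → ℕ → Ty → Tm → Tm → Tm
  | letUnit : Tm → Tm → Tm
deriving DecidableEq

/-- The values among the terms. -/
def isValue : Tm → Bool
  | .var _ _ => true
  | .cst _ _ => true
  | .star _ => true
  | .lam _ _ _ _ => true
  | .app _ _ => false
  | .pair _ V W => isValue V && isValue W
  | .letv _ _ V W => isValue V && isValue W
  | .letPair _ _ _ _ _ V W => isValue V && isValue W
  | .letUnit V W => isValue V && isValue W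

/-- Untyped (pure) terms. -/
inductive PTm : Type where
  | var : ℕ → PTm
  | cst : ℕ → PTm
  | star : PTm
  | lam : ℕ → PTm → PTm
  | app : PTm → PTm → PTm
  | pair : PTm → PTm → PTm
  | letv : ℕ → PTm → PTm → PTm
  | letPair : ℕ → ℕ → PTm → PTm → PTm
  | letUnit : PTm → PTm → PTm
deriving DecidableEq

/-- The erasure operation, deleting all type and integer annotations. -/
def erase : Tm → PTm
  | .var x _ => .var x
  | .cst c _ => .cst c
  | .star _ => .star
  | .lam _ x _ M => .lam x (erase M)
  | .app M N => .app (erase M) (erase N)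
  | .pair _ M N => .pair (erase M) (erase N)
  | .letv x _ M N => .letv x (erase M) (erase N)
  | .letPair _ x _ y _ M N => .letPair x y (erase M) (erase N)
  | .letUnit M N => .letUnit (erase M) (erase N)

/-- `FreeAt x A M` : the term `M` has a free instance `x^A` of the variable `x`. -/
inductive FreeAt (x : ℕ) : Ty → Tm → Prop where
  | var (A : Ty) : FreeAt x A (.var x A)
  | lam {A : Ty} {M : Tm} (n y : ℕ) (B : Ty) : y ≠ x → FreeAt x A M →
      FreeAt x A (.lam n y B M)
  | appL {A : Ty} {M : Tm} (N : Tm) : FreeAt x A M → FreeAt x A (.app M N)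
  | appR {A : Ty} {N : Tm} (M : Tm) : FreeAt x A N → FreeAt x A (.app M N)
  | pairL {A : Ty} {M : Tm} (n : ℕ) (N : Tm) : FreeAt x A M → FreeAt x A (.pair n M N)
  | pairR {A : Ty} {N : Tm} (n : ℕ) (M : Tm) : FreeAt x A N → FreeAt x A (.pair n M N)
  | letvL {A : Ty} {M : Tm} (y : ℕ) (B : Ty) (N : Tm) : FreeAt x A M →
      FreeAt x A (.letv y B M N)
  | letvR {A : Ty} {N : Tm} (y : ℕ) (B : Ty) (M : Tm) : y ≠ x → FreeAt x A N →
      FreeAt x A (.letv y B M N)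
  | letPairL {A : Ty} {M : Tm} (n y : ℕ) (B : Ty) (z : ℕ) (C : Ty) (N : Tm) :
      FreeAt x A M → FreeAt x A (.letPair n y B z C M N)
  | letPairR {A : Ty} {N : Tm} (n y : ℕ) (B : Ty) (z : ℕ) (C : Ty) (M : Tm) :
      y ≠ x → z ≠ x → FreeAt x A N → FreeAt x A (.letPair n y B z C M N)
  | letUnitL {A : Ty} {M : Tm} (N : Tm) : FreeAt x A M → FreeAt x A (.letUnit M N)
  | letUnitR {A : Ty} {N : Tm} (M : Tm) : FreeAt x A N → FreeAt x A (.letUnit M N)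

/-- `x` occurs free in `M`. -/
def Free (x : ℕ) (M : Tm) : Prop := ∃ A, FreeAt x A M

/-- Substitution on untyped terms. -/
def psubst (x : ℕ) (V : PTm) : PTm → PTm
  | .var y => if y = x then V else .var y
  | .cst c => .cst c
  | .star => .star
  | .lam y M => if y = x then .lam y M else .lam y (psubst x V M)
  | .app M N => .app (psubst x V M) (psubst x V N)
  | .pair M N => .pair (psubst x V M) (psubst x V N)
  | .letv y M N => .letv y (psubst x V M) (if y = x then N else psubst x V N)
  | .letPair y z M N =>
      .letPair y z (psubst x V M) (if y = x ∨ z = x then N else psubst x V N)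
  | .letUnit M N => .letUnit (psubst x V M) (psubst x V N)

/-- Typing contexts as (ordered) lists of typed variables. -/
abbrev CtxL : Type := List (ℕ × Ty)

/-- The names of the variables of a context. -/
def names (Γ : CtxL) : List ℕ := Γ.map Prod.fst

/-- `!Δ`: the context obtained from `Δ` by prefixing every type with `!`. -/
def bangify (Δ : CtxL) : CtxL := Δ.map (fun p => (p.1, Ty.bang p.2))

/-- Typing derivations for the rules of Table 1.  Contexts are treated as lists with
an explicit exchange rule `swap`.  The parameter `cty` assigns to each constant `c`
the type `A_c` (the type assigned to `c` being `!A_c`). -/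
inductive TypingD (cty : ℕ → Ty) : CtxL → Tm → Ty → Type where
  | swap {Γ₁ Γ₂ : CtxL} {p q : ℕ × Ty} {M : Tm} {A : Ty} :
      TypingD cty (Γ₁ ++ p :: q :: Γ₂) M A →
      TypingD cty (Γ₁ ++ q :: p :: Γ₂) M A
  | var {Δ : CtxL} {x : ℕ} {A B : Ty} :
      x ∉ names Δ → SubD A B →
      TypingD cty (bangify Δ ++ [(x, A)]) (.var x B) B
  | cst {Δ : CtxL} {c : ℕ} {B : Ty} :
      SubD (.bang (cty c)) B →
      TypingD cty (bangify Δ) (.cst c B) B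
  | star {Δ : CtxL} {n : ℕ} :
      TypingD cty (bangify Δ) (.star n) (bangN n .unit)
  | lam0 {Δ : CtxL} {x : ℕ} {A : Ty} {M : Tm} {B : Ty} :
      x ∉ names Δ → TypingD cty (Δ ++ [(x, A)]) M B →
      TypingD cty Δ (.lam 0 x A M) (.arrow A B)
  | lamS {Δ : CtxL} {n x : ℕ} {A : Ty} {M : Tm} {B : Ty} :
      x ∉ names Δ → TypingD cty (bangify Δ ++ [(x, A)]) M B →
      TypingD cty (bangify Δ) (.lam (n + 1) x A M) (bangN (n + 1) (.arrow A B))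
  | app {Δ Γ₁ Γ₂ : CtxL} {M N : Tm} {A B : Ty} :
      (names (bangify Δ ++ Γ₁ ++ Γ₂)).Nodup →
      TypingD cty (bangify Δ ++ Γ₁) M (.arrow A B) →
      TypingD cty (bangify Δ ++ Γ₂) N A →
      TypingD cty (bangify Δ ++ Γ₁ ++ Γ₂) (.app M N) B
  | pair {Δ Γ₁ Γ₂ : CtxL} {n : ℕ} {M₁ M₂ : Tm} {A₁ A₂ : Ty} :
      (names (bangify Δ ++ Γ₁ ++ Γ₂)).Nodup →
      TypingD cty (bangify Δ ++ Γ₁) M₁ (bangN n A₁) →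
      TypingD cty (bangify Δ ++ Γ₂) M₂ (bangN n A₂) →
      TypingD cty (bangify Δ ++ Γ₁ ++ Γ₂) (.pair n M₁ M₂) (bangN n (.tensor A₁ A₂))
  | letv {Δ Γ₁ Γ₂ : CtxL} {x : ℕ} {A : Ty} {M N : Tm} {B : Ty} :
      (names (bangify Δ ++ Γ₁ ++ Γ₂)).Nodup →
      x ∉ names (bangify Δ ++ Γ₁ ++ Γ₂) →
      TypingD cty (bangify Δ ++ Γ₁) M A →
      TypingD cty ((bangify Δ ++ Γ₂) ++ [(x, A)]) N B →
      TypingD cty (bangify Δ ++ Γ₁ ++ Γ₂) (.letv x A M N) B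
  | letUnit {Δ Γ₁ Γ₂ : CtxL} {M N : Tm} {A : Ty} :
      (names (bangify Δ ++ Γ₁ ++ Γ₂)).Nodup →
      TypingD cty (bangify Δ ++ Γ₁) M .unit →
      TypingD cty (bangify Δ ++ Γ₂) N A →
      TypingD cty (bangify Δ ++ Γ₁ ++ Γ₂) (.letUnit M N) A
  | letPair {Δ Γ₁ Γ₂ : CtxL} {n x₁ : ℕ} {A₁ : Ty} {x₂ : ℕ} {A₂ : Ty} {M N : Tm} {A : Ty} :
      (names (bangify Δ ++ Γ₁ ++ Γ₂)).Nodup →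
      x₁ ≠ x₂ →
      x₁ ∉ names (bangify Δ ++ Γ₁ ++ Γ₂) →
      x₂ ∉ names (bangify Δ ++ Γ₁ ++ Γ₂) →
      TypingD cty (bangify Δ ++ Γ₁) M (bangN n (.tensor A₁ A₂)) →
      TypingD cty ((bangify Δ ++ Γ₂) ++ [(x₁, bangN n A₁), (x₂, bangN n A₂)]) N A →
      TypingD cty (bangify Δ ++ Γ₁ ++ Γ₂) (.letPair n x₁ A₁ x₂ A₂ M N) A

/-- Validity of a typing judgment. -/
def Typ (cty : ℕ → Ty) (Γ : CtxL) (M : Tm) (A : Ty) : Prop :=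
  Nonempty (TypingD cty Γ M A)

end QLamSem

namespace QLamSem

/-- The data of a linear category for duplication: a symmetric monoidal category,
an idempotent strongly monoidal linear exponential comonad `(L,δ,ε,m₂,m₀,△,◇)`,
a strong monad `(T,η,μ,t)`, and Kleisli exponentials `⊸` with `Φ`. -/
structure LCDData : Type 1 where
  Obj : Type
  Hom : Obj → Obj → Type
  id : ∀ A, Hom A A
  comp : ∀ {A B C}, Hom A B → Hom B C → Hom A C
  tens : Obj → Obj → Obj
  unit : Obj
  tmap : ∀ {A B X Y}, Hom A B → Hom X Y → Hom (tens A X) (tens B Y)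
  assoc : ∀ A B X, Hom (tens (tens A B) X) (tens A (tens B X))
  assocInv : ∀ A B X, Hom (tens A (tens B X)) (tens (tens A B) X)
  lunit : ∀ A, Hom (tens unit A) A
  lunitInv : ∀ A, Hom A (tens unit A)
  runit : ∀ A, Hom (tens A unit) A
  runitInv : ∀ A, Hom A (tens A unit)
  symm : ∀ A B, Hom (tens A B) (tens B A)
  L : Obj → Obj
  Lmap : ∀ {A B}, Hom A B → Hom (L A) (L B)
  eps : ∀ A, Hom (L A) A
  delta : ∀ A, Hom (L A) (L (L A))
  deltaInv : ∀ A, Hom (L (L A)) (L A)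
  m2 : ∀ A B, Hom (tens (L A) (L B)) (L (tens A B))
  m2Inv : ∀ A B, Hom (L (tens A B)) (tens (L A) (L B))
  m0 : Hom unit (L unit)
  m0Inv : Hom (L unit) unit
  dup : ∀ A, Hom (L A) (tens (L A) (L A))
  disc : ∀ A, Hom (L A) unit
  T : Obj → Obj
  Tmap : ∀ {A B}, Hom A B → Hom (T A) (T B)
  eta : ∀ A, Hom A (T A)
  mu : ∀ A, Hom (T (T A)) (T A)
  str : ∀ A B, Hom (tens A (T B)) (T (tens A B))
  lolli : Obj → Obj → Obj
  lolliL : ∀ {A' A} (_ : Hom A' A) (B : Obj), Hom (lolli A B) (lolli A' B)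
  lolliR : ∀ (A : Obj) {B B'} (_ : Hom B B'), Hom (lolli A B) (lolli A B')
  Phi : ∀ {X A B}, Hom X (lolli A B) → Hom (tens X A) (T B)
  PhiInv : ∀ {X A B}, Hom (tens X A) (T B) → Hom X (lolli A B)

namespace LCDData

variable (D : LCDData)

/-- Kleisli lifting `f* = T f ; μ`. -/
def klift {A B : D.Obj} (f : D.Hom A (D.T B)) : D.Hom (D.T A) (D.T B) :=
  D.comp (D.Tmap f) (D.mu B)

/-- `Ψ₁ : TA ⊗ TB → T(A ⊗ B)` (first component first). -/
def Psi1 (A B : D.Obj) : D.Hom (D.tens (D.T A) (D.T B)) (D.T (D.tens A B)) :=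
  D.comp (D.symm (D.T A) (D.T B))
    (D.comp (D.str (D.T B) A)
      (D.klift (D.comp (D.symm (D.T B) A) (D.str A B))))

/-- The evaluation map `(A ⊸ B) ⊗ A → T B` induced by `Φ`. -/
def appnt (A B : D.Obj) : D.Hom (D.tens (D.lolli A B) A) (D.T B) :=
  D.Phi (D.id (D.lolli A B))

/-- Transport of homs along equalities of objects. -/
def castHom {A A' B B' : D.Obj} (h₁ : A = A') (h₂ : B = B') (f : D.Hom A B) :
    D.Hom A' B' := h₁ ▸ h₂ ▸ f

end LCDData

/-- The laws of a linear category for duplication (Definition of linear category for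
duplication: symmetric monoidal category, idempotent strongly monoidal linear
exponential comonad, strong monad, Kleisli exponentials). -/
structure LCDLaws (D : LCDData) : Prop where
  /- category -/
  id_comp : ∀ {A B} (f : D.Hom A B), D.comp (D.id A) f = f
  comp_id : ∀ {A B} (f : D.Hom A B), D.comp f (D.id B) = f
  comp_assoc : ∀ {A B C E} (f : D.Hom A B) (g : D.Hom B C) (h : D.Hom C E),
    D.comp (D.comp f g) h = D.comp f (D.comp g h)
  /- monoidal structure -/
  tmap_id : ∀ A B, D.tmap (D.id A) (D.id B) = D.id (D.tens A B)
  tmap_comp : ∀ {A B C X Y Z} (f : D.Hom A B) (g : D.Hom B C)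
    (h : D.Hom X Y) (k : D.Hom Y Z),
    D.tmap (D.comp f g) (D.comp h k) = D.comp (D.tmap f h) (D.tmap g k)
  assoc_iso₁ : ∀ A B X, D.comp (D.assoc A B X) (D.assocInv A B X) = D.id _
  assoc_iso₂ : ∀ A B X, D.comp (D.assocInv A B X) (D.assoc A B X) = D.id _
  assoc_natural : ∀ {A A' B B' X X'} (f : D.Hom A A') (g : D.Hom B B') (h : D.Hom X X'),
    D.comp (D.tmap (D.tmap f g) h) (D.assoc A' B' X')
      = D.comp (D.assoc A B X) (D.tmap f (D.tmap g h))
  lunit_iso₁ : ∀ A, D.comp (D.lunit A) (D.lunitInv A) = D.id _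
  lunit_iso₂ : ∀ A, D.comp (D.lunitInv A) (D.lunit A) = D.id _
  lunit_natural : ∀ {A A'} (f : D.Hom A A'),
    D.comp (D.tmap (D.id D.unit) f) (D.lunit A') = D.comp (D.lunit A) f
  runit_iso₁ : ∀ A, D.comp (D.runit A) (D.runitInv A) = D.id _
  runit_iso₂ : ∀ A, D.comp (D.runitInv A) (D.runit A) = D.id _
  runit_natural : ∀ {A A'} (f : D.Hom A A'),
    D.comp (D.tmap f (D.id D.unit)) (D.runit A') = D.comp (D.runit A) f
  pentagon : ∀ A B X Y,
    D.comp (D.assoc (D.tens A B) X Y) (D.assoc A B (D.tens X Y))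
      = D.comp (D.tmap (D.assoc A B X) (D.id Y))
          (D.comp (D.assoc A (D.tens B X) Y) (D.tmap (D.id A) (D.assoc B X Y)))
  triangle : ∀ A B,
    D.comp (D.assoc A D.unit B) (D.tmap (D.id A) (D.lunit B))
      = D.tmap (D.runit A) (D.id B)
  symm_natural : ∀ {A A' B B'} (f : D.Hom A A') (g : D.Hom B B'),
    D.comp (D.tmap f g) (D.symm A' B') = D.comp (D.symm A B) (D.tmap g f)
  symm_symm : ∀ A B, D.comp (D.symm A B) (D.symm B A) = D.id _
  hexagon : ∀ A B X,
    D.comp (D.assoc A B X) (D.comp (D.symm A (D.tens B X)) (D.assoc B X A))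
      = D.comp (D.tmap (D.symm A B) (D.id X))
          (D.comp (D.assoc B A X) (D.tmap (D.id B) (D.symm A X)))
  /- the comonad L -/
  Lmap_id : ∀ A, D.Lmap (D.id A) = D.id (D.L A)
  Lmap_comp : ∀ {A B C} (f : D.Hom A B) (g : D.Hom B C),
    D.Lmap (D.comp f g) = D.comp (D.Lmap f) (D.Lmap g)
  eps_natural : ∀ {A B} (f : D.Hom A B),
    D.comp (D.Lmap f) (D.eps B) = D.comp (D.eps A) f
  delta_natural : ∀ {A B} (f : D.Hom A B),
    D.comp (D.Lmap f) (D.delta B) = D.comp (D.delta A) (D.Lmap (D.Lmap f))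
  delta_assoc : ∀ A, D.comp (D.delta A) (D.delta (D.L A))
    = D.comp (D.delta A) (D.Lmap (D.delta A))
  delta_counit_left : ∀ A, D.comp (D.delta A) (D.eps (D.L A)) = D.id (D.L A)
  delta_counit_right : ∀ A, D.comp (D.delta A) (D.Lmap (D.eps A)) = D.id (D.L A)
  /- idempotency -/
  delta_iso₁ : ∀ A, D.comp (D.delta A) (D.deltaInv A) = D.id _
  delta_iso₂ : ∀ A, D.comp (D.deltaInv A) (D.delta A) = D.id _
  /- monoidality of L (strong monoidal comonad) -/
  m2_natural : ∀ {A A' B B'} (f : D.Hom A A') (g : D.Hom B B'),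
    D.comp (D.tmap (D.Lmap f) (D.Lmap g)) (D.m2 A' B')
      = D.comp (D.m2 A B) (D.Lmap (D.tmap f g))
  m2_iso₁ : ∀ A B, D.comp (D.m2 A B) (D.m2Inv A B) = D.id _
  m2_iso₂ : ∀ A B, D.comp (D.m2Inv A B) (D.m2 A B) = D.id _
  m0_iso₁ : D.comp D.m0 D.m0Inv = D.id _
  m0_iso₂ : D.comp D.m0Inv D.m0 = D.id _
  m2_assoc : ∀ A B X,
    D.comp (D.tmap (D.m2 A B) (D.id (D.L X)))
      (D.comp (D.m2 (D.tens A B) X) (D.Lmap (D.assoc A B X)))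
    = D.comp (D.assoc (D.L A) (D.L B) (D.L X))
        (D.comp (D.tmap (D.id (D.L A)) (D.m2 B X)) (D.m2 A (D.tens B X)))
  m2_left_unit : ∀ B,
    D.comp (D.tmap D.m0 (D.id (D.L B))) (D.comp (D.m2 D.unit B) (D.Lmap (D.lunit B)))
      = D.lunit (D.L B)
  m2_right_unit : ∀ A,
    D.comp (D.tmap (D.id (D.L A)) D.m0) (D.comp (D.m2 A D.unit) (D.Lmap (D.runit A)))
      = D.runit (D.L A)
  eps_monoidal : ∀ A B,
    D.comp (D.m2 A B) (D.eps (D.tens A B)) = D.tmap (D.eps A) (D.eps B)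
  eps_monoidal_unit : D.comp D.m0 (D.eps D.unit) = D.id D.unit
  delta_monoidal : ∀ A B,
    D.comp (D.m2 A B) (D.delta (D.tens A B))
      = D.comp (D.tmap (D.delta A) (D.delta B))
          (D.comp (D.m2 (D.L A) (D.L B)) (D.Lmap (D.m2 A B)))
  delta_monoidal_unit : D.comp D.m0 (D.delta D.unit) = D.comp D.m0 (D.Lmap D.m0)
  /- each LA is a commutative comonoid (LA, △, ◇) -/
  dup_natural : ∀ {A B} (f : D.Hom A B),
    D.comp (D.Lmap f) (D.dup B) = D.comp (D.dup A) (D.tmap (D.Lmap f) (D.Lmap f))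
  disc_natural : ∀ {A B} (f : D.Hom A B),
    D.comp (D.Lmap f) (D.disc B) = D.disc A
  dup_comm : ∀ A, D.comp (D.dup A) (D.symm (D.L A) (D.L A)) = D.dup A
  dup_assoc : ∀ A,
    D.comp (D.dup A) (D.comp (D.tmap (D.dup A) (D.id (D.L A)))
      (D.assoc (D.L A) (D.L A) (D.L A)))
    = D.comp (D.dup A) (D.tmap (D.id (D.L A)) (D.dup A))
  dup_counit_left : ∀ A,
    D.comp (D.dup A) (D.comp (D.tmap (D.disc A) (D.id (D.L A))) (D.lunit (D.L A)))
      = D.id (D.L A)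
  dup_counit_right : ∀ A,
    D.comp (D.dup A) (D.comp (D.tmap (D.id (D.L A)) (D.disc A)) (D.runit (D.L A)))
      = D.id (D.L A)
  /- △ and ◇ are monoidal natural transformations (Table 3, first group) -/
  dup_monoidal : ∀ A B,
    D.comp (D.m2 A B) (D.dup (D.tens A B))
      = D.comp (D.tmap (D.dup A) (D.dup B))
          (D.comp (D.comp (D.assoc (D.L A) (D.L A) (D.tens (D.L B) (D.L B)))
              (D.comp (D.tmap (D.id (D.L A)) (D.comp
                  (D.assocInv (D.L A) (D.L B) (D.L B))
                  (D.comp (D.tmap (D.symm (D.L A) (D.L B)) (D.id (D.L B)))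
                    (D.assoc (D.L B) (D.L A) (D.L B)))))
                (D.assocInv (D.L A) (D.L B) (D.tens (D.L A) (D.L B)))))
            (D.tmap (D.m2 A B) (D.m2 A B)))
  dup_monoidal_unit :
    D.comp D.m0 (D.dup D.unit) = D.comp (D.lunitInv D.unit) (D.tmap D.m0 D.m0)
  disc_monoidal : ∀ A B,
    D.comp (D.m2 A B) (D.disc (D.tens A B))
      = D.comp (D.tmap (D.disc A) (D.disc B)) (D.lunit D.unit)
  disc_monoidal_unit : D.comp D.m0 (D.disc D.unit) = D.id D.unit
  /- △ and ◇ are L-coalgebra morphisms (Table 3, second group) -/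
  dup_coalgebra : ∀ A,
    D.comp (D.delta A) (D.Lmap (D.dup A))
      = D.comp (D.dup A) (D.comp (D.tmap (D.delta A) (D.delta A)) (D.m2 (D.L A) (D.L A)))
  disc_coalgebra : ∀ A,
    D.comp (D.delta A) (D.Lmap (D.disc A)) = D.comp (D.disc A) D.m0
  /- δ is a comonoid morphism (Table 3, third group) -/
  delta_comonoid_dup : ∀ A,
    D.comp (D.delta A) (D.dup (D.L A)) = D.comp (D.dup A) (D.tmap (D.delta A) (D.delta A))
  delta_comonoid_disc : ∀ A,
    D.comp (D.delta A) (D.disc (D.L A)) = D.disc A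
  /- the monad T -/
  Tmap_id : ∀ A, D.Tmap (D.id A) = D.id (D.T A)
  Tmap_comp : ∀ {A B C} (f : D.Hom A B) (g : D.Hom B C),
    D.Tmap (D.comp f g) = D.comp (D.Tmap f) (D.Tmap g)
  eta_natural : ∀ {A B} (f : D.Hom A B),
    D.comp f (D.eta B) = D.comp (D.eta A) (D.Tmap f)
  mu_natural : ∀ {A B} (f : D.Hom A B),
    D.comp (D.Tmap (D.Tmap f)) (D.mu B) = D.comp (D.mu A) (D.Tmap f)
  mu_assoc : ∀ A, D.comp (D.Tmap (D.mu A)) (D.mu A) = D.comp (D.mu (D.T A)) (D.mu A)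
  mu_unit_left : ∀ A, D.comp (D.eta (D.T A)) (D.mu A) = D.id (D.T A)
  mu_unit_right : ∀ A, D.comp (D.Tmap (D.eta A)) (D.mu A) = D.id (D.T A)
  /- tensorial strength -/
  str_natural : ∀ {A A' B B'} (f : D.Hom A A') (g : D.Hom B B'),
    D.comp (D.tmap f (D.Tmap g)) (D.str A' B') = D.comp (D.str A B) (D.Tmap (D.tmap f g))
  str_lunit : ∀ B,
    D.comp (D.str D.unit B) (D.Tmap (D.lunit B)) = D.lunit (D.T B)
  str_assoc : ∀ A B X,
    D.comp (D.assoc A B (D.T X)) (D.comp (D.tmap (D.id A) (D.str B X)) (D.str A (D.tens B X)))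
      = D.comp (D.str (D.tens A B) X) (D.Tmap (D.assoc A B X))
  str_eta : ∀ A B, D.comp (D.tmap (D.id A) (D.eta B)) (D.str A B) = D.eta (D.tens A B)
  str_mu : ∀ A B,
    D.comp (D.tmap (D.id A) (D.mu B)) (D.str A B)
      = D.comp (D.str A (D.T B)) (D.comp (D.Tmap (D.str A B)) (D.mu (D.tens A B)))
  /- Kleisli exponentials -/
  lolliL_id : ∀ A B, D.lolliL (D.id A) B = D.id (D.lolli A B)
  lolliR_id : ∀ A B, D.lolliR A (D.id B) = D.id (D.lolli A B)
  lolliL_comp : ∀ {A'' A' A} (f : D.Hom A'' A') (g : D.Hom A' A) (B : D.Obj),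
    D.lolliL (D.comp f g) B = D.comp (D.lolliL g B) (D.lolliL f B)
  lolliR_comp : ∀ (A : D.Obj) {B B' B''} (f : D.Hom B B') (g : D.Hom B' B''),
    D.lolliR A (D.comp f g) = D.comp (D.lolliR A f) (D.lolliR A g)
  Phi_iso₁ : ∀ {X A B} (f : D.Hom X (D.lolli A B)), D.PhiInv (D.Phi f) = f
  Phi_iso₂ : ∀ {X A B} (g : D.Hom (D.tens X A) (D.T B)), D.Phi (D.PhiInv g) = g
  Phi_natural_left : ∀ {X' X A B} (f : D.Hom X' X) (g : D.Hom X (D.lolli A B)),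
    D.Phi (D.comp f g) = D.comp (D.tmap f (D.id A)) (D.Phi g)
  Phi_natural_right : ∀ {X A B B'} (g : D.Hom X (D.lolli A B)) (h : D.Hom B B'),
    D.Phi (D.comp g (D.lolliR A h)) = D.comp (D.Phi g) (D.Tmap h)
  Phi_natural_arg : ∀ {X A' A B} (f : D.Hom A' A) (g : D.Hom X (D.lolli A B)),
    D.Phi (D.comp g (D.lolliL f B)) = D.comp (D.tmap (D.id X) f) (D.Phi g)

end QLamSem

namespace QLamSem

variable (D : LCDData)

/-- `Ln n X = Lⁿ X`. -/
def Ln : ℕ → D.Obj → D.Obj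
  | 0, X => X
  | n + 1, X => D.L (Ln n X)

/-- `Lⁿ` on morphisms. -/
def LnMap : ∀ (n : ℕ) {X Y : D.Obj}, D.Hom X Y → D.Hom (Ln D n X) (Ln D n Y)
  | 0, _, _, f => f
  | n + 1, _, _, f => D.Lmap (LnMap n f)

/-- Iterated counit `Lⁿ X → X`. -/
def collapseL : ∀ (n : ℕ) (X : D.Obj), D.Hom (Ln D n X) X
  | 0, X => D.id X
  | n + 1, X => D.comp (D.eps (Ln D n X)) (collapseL n X)

/-- Iterated comultiplication `L X → Lᵐ⁺¹ X`. -/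
def padL : ∀ (m : ℕ) (X : D.Obj), D.Hom (D.L X) (Ln D (m + 1) X)
  | 0, X => D.id (D.L X)
  | m + 1, X => D.comp (padL m X) (D.delta (Ln D m X))

/-- The canonical morphism `Lⁿ X → Lᵐ X` for `m = 0 ∨ 1 ≤ n`. -/
def bangAdj : ∀ (n m : ℕ) (X : D.Obj), (m = 0 ∨ 1 ≤ n) → D.Hom (Ln D n X) (Ln D m X)
  | n, 0, X, _ => collapseL D n X
  | 0, m + 1, _, h => False.elim (by omega)
  | n + 1, m + 1, X, _ =>
      D.comp (D.Lmap (collapseL D n X)) (padL D m X)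

/-- Iterated monoidality map `Lⁿ a ⊗ Lⁿ b → Lⁿ (a ⊗ b)`. -/
def m2n : ∀ (n : ℕ) (a b : D.Obj), D.Hom (D.tens (Ln D n a) (Ln D n b)) (Ln D n (D.tens a b))
  | 0, a, b => D.id (D.tens a b)
  | n + 1, a, b => D.comp (D.m2 (Ln D n a) (Ln D n b)) (D.Lmap (m2n n a b))

/-- Inverse of `m2n`. -/
def m2nInv : ∀ (n : ℕ) (a b : D.Obj), D.Hom (Ln D n (D.tens a b)) (D.tens (Ln D n a) (Ln D n b))
  | 0, a, b => D.id (D.tens a b)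
  | n + 1, a, b => D.comp (D.Lmap (m2nInv n a b)) (D.m2Inv (Ln D n a) (Ln D n b))

variable (Θ : ℕ → D.Obj)

/-- Interpretation of types. -/
def denTy : Ty → D.Obj
  | .tconst a => Θ a
  | .arrow A B => D.lolli (denTy A) (denTy B)
  | .tensor A B => D.tens (denTy A) (denTy B)
  | .unit => D.unit
  | .bang A => D.L (denTy A)

theorem denTy_bangN (n : ℕ) (A : Ty) : denTy D Θ (bangN n A) = Ln D n (denTy D Θ A) := by
  induction n with
  | zero => rfl
  | succ n ih => simp [bangN, denTy, Ln, ih]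


/-- The identity viewed along an equality of objects. -/
def eqHom {A B : D.Obj} (h : A = B) : D.Hom A B := h ▸ D.id A

/-- Interpretation of contexts: `⟦x₁:A₁,…,xₙ:Aₙ⟧ = ⟦A₁⟧ ⊗ (… ⊗ (⟦Aₙ⟧ ⊗ ⊤))`. -/
def denCtx : CtxL → D.Obj
  | [] => D.unit
  | p :: Γ => D.tens (denTy D Θ p.2) (denCtx Γ)

/-- Splitting `⟦Γ₁ ++ Γ₂⟧ → ⟦Γ₁⟧ ⊗ ⟦Γ₂⟧`. -/
def splitCtx : ∀ (Γ₁ Γ₂ : CtxL), D.Hom (denCtx D Θ (Γ₁ ++ Γ₂)) (D.tens (denCtx D Θ Γ₁) (denCtx D Θ Γ₂))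
  | [], Γ₂ => D.lunitInv (denCtx D Θ Γ₂)
  | p :: Γ₁, Γ₂ =>
      D.comp (D.tmap (D.id (denTy D Θ p.2)) (splitCtx Γ₁ Γ₂))
        (D.assocInv (denTy D Θ p.2) (denCtx D Θ Γ₁) (denCtx D Θ Γ₂))

/-- Joining `⟦Γ₁⟧ ⊗ ⟦Γ₂⟧ → ⟦Γ₁ ++ Γ₂⟧`. -/
def joinCtx : ∀ (Γ₁ Γ₂ : CtxL), D.Hom (D.tens (denCtx D Θ Γ₁) (denCtx D Θ Γ₂)) (denCtx D Θ (Γ₁ ++ Γ₂))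
  | [], Γ₂ => D.lunit (denCtx D Θ Γ₂)
  | p :: Γ₁, Γ₂ =>
      D.comp (D.assoc (denTy D Θ p.2) (denCtx D Θ Γ₁) (denCtx D Θ Γ₂))
        (D.tmap (D.id (denTy D Θ p.2)) (joinCtx Γ₁ Γ₂))

/-- The middle-four interchange `(a⊗b)⊗(c⊗d) → (a⊗c)⊗(b⊗d)`. -/
def mid4 (a b c d : D.Obj) :
    D.Hom (D.tens (D.tens a b) (D.tens c d)) (D.tens (D.tens a c) (D.tens b d)) :=
  D.comp (D.assoc a b (D.tens c d))
    (D.comp (D.tmap (D.id a)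
        (D.comp (D.assocInv b c d)
          (D.comp (D.tmap (D.symm b c) (D.id d)) (D.assoc c b d))))
      (D.assocInv a c (D.tens b d)))

/-- Duplication of a `!`-context, built from the comonoid comultiplications `△`. -/
def dupCtx : ∀ (Δ : CtxL), D.Hom (denCtx D Θ (bangify Δ)) (D.tens (denCtx D Θ (bangify Δ)) (denCtx D Θ (bangify Δ)))
  | [] => D.lunitInv D.unit
  | p :: Δ =>
      D.comp (D.tmap (D.dup (denTy D Θ p.2)) (dupCtx Δ))
        (mid4 D (D.L (denTy D Θ p.2)) (D.L (denTy D Θ p.2))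
          (denCtx D Θ (bangify Δ)) (denCtx D Θ (bangify Δ)))

/-- Discarding of a `!`-context, built from the comonoid counits `◇`. -/
def discCtx : ∀ (Δ : CtxL), D.Hom (denCtx D Θ (bangify Δ)) D.unit
  | [] => D.id D.unit
  | p :: Δ => D.comp (D.tmap (D.disc (denTy D Θ p.2)) (discCtx Δ)) (D.lunit D.unit)

/-- Promotion of a `!`-context: `⟦!Δ⟧ → L ⟦!Δ⟧`, built from `δ` and `m₂`. -/
def promCtx : ∀ (Δ : CtxL), D.Hom (denCtx D Θ (bangify Δ)) (D.L (denCtx D Θ (bangify Δ)))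
  | [] => D.m0
  | p :: Δ =>
      D.comp (D.tmap (D.delta (denTy D Θ p.2)) (promCtx Δ))
        (D.m2 (D.L (denTy D Θ p.2)) (denCtx D Θ (bangify Δ)))

/-- `Split_{!Δ,Γ₁,Γ₂} : ⟦!Δ,Γ₁,Γ₂⟧ → ⟦!Δ,Γ₁⟧ ⊗ ⟦!Δ,Γ₂⟧`, duplicating the `!Δ` part. -/
def splitDup (Δ Γ₁ Γ₂ : CtxL) :
    D.Hom (denCtx D Θ (bangify Δ ++ Γ₁ ++ Γ₂))
      (D.tens (denCtx D Θ (bangify Δ ++ Γ₁)) (denCtx D Θ (bangify Δ ++ Γ₂))) :=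
  D.comp (eqHom D (congrArg (denCtx D Θ) (List.append_assoc (bangify Δ) Γ₁ Γ₂)))
  <| D.comp (splitCtx D Θ (bangify Δ) (Γ₁ ++ Γ₂))
    (D.comp (D.tmap (dupCtx D Θ Δ) (splitCtx D Θ Γ₁ Γ₂))
      (D.comp (mid4 D (denCtx D Θ (bangify Δ)) (denCtx D Θ (bangify Δ))
          (denCtx D Θ Γ₁) (denCtx D Θ Γ₂))
        (D.tmap (joinCtx D Θ (bangify Δ) Γ₁) (joinCtx D Θ (bangify Δ) Γ₂))))

/-- `⟦Γ⟧ ⊗ ⟦A⟧ → ⟦Γ, x:A⟧`. -/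
def extHom (Γ : CtxL) (x : ℕ) (A : Ty) :
    D.Hom (D.tens (denCtx D Θ Γ) (denTy D Θ A)) (denCtx D Θ (Γ ++ [(x, A)])) :=
  D.comp (D.tmap (D.id (denCtx D Θ Γ)) (D.runitInv (denTy D Θ A)))
    (joinCtx D Θ Γ [(x, A)])

/-- `⟦Γ⟧ ⊗ (⟦A₁⟧ ⊗ ⟦A₂⟧) → ⟦Γ, x₁:A₁, x₂:A₂⟧`. -/
def ext2Hom (Γ : CtxL) (x₁ : ℕ) (A₁ : Ty) (x₂ : ℕ) (A₂ : Ty) :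
    D.Hom (D.tens (denCtx D Θ Γ) (D.tens (denTy D Θ A₁) (denTy D Θ A₂)))
      (denCtx D Θ (Γ ++ [(x₁, A₁), (x₂, A₂)])) :=
  D.comp (D.tmap (D.id (denCtx D Θ Γ))
      (D.tmap (D.id (denTy D Θ A₁)) (D.runitInv (denTy D Θ A₂))))
    (joinCtx D Θ Γ [(x₁, A₁), (x₂, A₂)])

/-- The exchange morphism interpreting the `swap` rule. -/
def swapMor (Γ₁ : CtxL) (p q : ℕ × Ty) (Γ₂ : CtxL) :
    D.Hom (denCtx D Θ (Γ₁ ++ q :: p :: Γ₂)) (denCtx D Θ (Γ₁ ++ p :: q :: Γ₂)) :=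
  D.comp (splitCtx D Θ Γ₁ (q :: p :: Γ₂))
    (D.comp (D.tmap (D.id (denCtx D Θ Γ₁))
        (D.comp (D.assocInv (denTy D Θ q.2) (denTy D Θ p.2) (denCtx D Θ Γ₂))
          (D.comp (D.tmap (D.symm (denTy D Θ q.2) (denTy D Θ p.2)) (D.id (denCtx D Θ Γ₂)))
            (D.assoc (denTy D Θ p.2) (denTy D Θ q.2) (denCtx D Θ Γ₂)))))
      (joinCtx D Θ Γ₁ (p :: q :: Γ₂)))

/-- The canonical arrow `I_{A,B} : ⟦A⟧ → ⟦B⟧` interpreting a subtyping `A <: B`. -/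
def Isub : ∀ {A B : Ty}, SubD A B → D.Hom (denTy D Θ A) (denTy D Θ B)
  | _, _, .tconst n m a h =>
      D.castHom (denTy_bangN D Θ n (Ty.tconst a)).symm (denTy_bangN D Θ m (Ty.tconst a)).symm
        (bangAdj D n m (denTy D Θ (Ty.tconst a)) h)
  | _, _, .unit n m h =>
      D.castHom (denTy_bangN D Θ n Ty.unit).symm (denTy_bangN D Θ m Ty.unit).symm
        (bangAdj D n m (denTy D Θ Ty.unit) h)
  | _, _, .arrow n m A A' B B' h sA sB =>
      D.castHom (denTy_bangN D Θ n (Ty.arrow A' B)).symm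
        (denTy_bangN D Θ m (Ty.arrow A B')).symm
        (D.comp (bangAdj D n m (denTy D Θ (Ty.arrow A' B)) h)
          (LnMap D m (D.comp (D.lolliL (Isub sA) (denTy D Θ B)) (D.lolliR (denTy D Θ A) (Isub sB)))))
  | _, _, .tensor n m A A' B B' h sA sB =>
      D.castHom (denTy_bangN D Θ n (Ty.tensor A B)).symm
        (denTy_bangN D Θ m (Ty.tensor A' B')).symm
        (D.comp (bangAdj D n m (denTy D Θ (Ty.tensor A B)) h)
          (LnMap D m (D.tmap (Isub sA) (Isub sB))))

/-- `m2n` expressed on interpretations of types. -/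
def m2nD (n : ℕ) (A B : Ty) :
    D.Hom (D.tens (denTy D Θ (bangN n A)) (denTy D Θ (bangN n B)))
      (denTy D Θ (bangN n (Ty.tensor A B))) :=
  D.castHom
    (show D.tens (Ln D n (denTy D Θ A)) (Ln D n (denTy D Θ B))
        = D.tens (denTy D Θ (bangN n A)) (denTy D Θ (bangN n B)) by
      rw [denTy_bangN, denTy_bangN])
    (denTy_bangN D Θ n (Ty.tensor A B)).symm
    (m2n D n (denTy D Θ A) (denTy D Θ B))

/-- Inverse of `m2nD`. -/
def m2nDInv (n : ℕ) (A B : Ty) :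
    D.Hom (denTy D Θ (bangN n (Ty.tensor A B)))
      (D.tens (denTy D Θ (bangN n A)) (denTy D Θ (bangN n B))) :=
  D.castHom (denTy_bangN D Θ n (Ty.tensor A B)).symm
    (show D.tens (Ln D n (denTy D Θ A)) (Ln D n (denTy D Θ B))
        = D.tens (denTy D Θ (bangN n A)) (denTy D Θ (bangN n B)) by
      rw [denTy_bangN, denTy_bangN])
    (m2nInv D n (denTy D Θ A) (denTy D Θ B))

/-- `⊤ → ⟦!ⁿ⊤⟧`. -/
def starMap : ∀ n : ℕ, D.Hom D.unit (denTy D Θ (bangN n Ty.unit))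
  | 0 => D.id D.unit
  | n + 1 =>
      D.comp D.m0 (D.castHom rfl (denTy_bangN D Θ (n + 1) Ty.unit).symm (padL D n D.unit))

/-- An interpretation `Θ` of the language: an object for each type constant and an
arrow `⊤ → ⟦!A_c⟧` for each constant `c` (whose assigned type is `!A_c`). -/
structure Interp (cty : ℕ → Ty) : Type where
  obj : ℕ → D.Obj
  cst : ∀ c : ℕ, D.Hom D.unit (denTy D obj (Ty.bang (cty c)))

variable {D}
variable {cty : ℕ → Ty} (I : Interp D cty)

/-- The computational interpretation `⟦π⟧^c : ⟦Γ⟧ → T ⟦A⟧` of a typing derivation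
`π` of `Γ ⊢ M : A` (Table 5). -/
def denC : ∀ {Γ : CtxL} {M : Tm} {A : Ty}, TypingD cty Γ M A →
    D.Hom (denCtx D I.obj Γ) (D.T (denTy D I.obj A))
  | _, _, _, .swap (Γ₁ := Γ₁) (Γ₂ := Γ₂) (p := p) (q := q) d =>
      D.comp (swapMor D I.obj Γ₁ p q Γ₂) (denC d)
  | _, _, _, .var (Δ := Δ) (x := x) (A := A) _ s =>
      D.comp (splitCtx D I.obj (bangify Δ) [(x, A)])
        (D.comp (D.tmap (discCtx D I.obj Δ) (D.runit (denTy D I.obj A)))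
          (D.comp (D.lunit (denTy D I.obj A))
            (D.comp (Isub D I.obj s) (D.eta _))))
  | _, _, _, .cst (Δ := Δ) (c := c) s =>
      D.comp (discCtx D I.obj Δ)
        (D.comp (I.cst c) (D.comp (Isub D I.obj s) (D.eta _)))
  | _, _, _, .star (Δ := Δ) (n := n) =>
      D.comp (discCtx D I.obj Δ) (D.comp (starMap D I.obj n) (D.eta _))
  | _, _, _, .lam0 (Δ := Δ) (x := x) (A := A) _ d =>
      D.comp (D.PhiInv (D.comp (extHom D I.obj Δ x A) (denC d))) (D.eta _)
  | _, _, _, .lamS (Δ := Δ) (n := n) (x := x) (A := A) (B := B) _ d =>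
      D.comp (promCtx D I.obj Δ)
        (D.comp (D.Lmap (D.PhiInv (D.comp (extHom D I.obj (bangify Δ) x A) (denC d))))
          (D.comp (D.castHom rfl (denTy_bangN D I.obj (n + 1) (Ty.arrow A B)).symm
              (padL D n (denTy D I.obj (Ty.arrow A B))))
            (D.eta _)))
  | _, _, _, .app (Δ := Δ) (Γ₁ := Γ₁) (Γ₂ := Γ₂) (A := A) (B := B) _ d₁ d₂ =>
      D.comp (splitDup D I.obj Δ Γ₁ Γ₂)
        (D.comp (D.tmap (denC d₁) (denC d₂))
          (D.comp (D.Psi1 (denTy D I.obj (Ty.arrow A B)) (denTy D I.obj A))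
            (D.klift (D.appnt (denTy D I.obj A) (denTy D I.obj B)))))
  | _, _, _, .pair (Δ := Δ) (Γ₁ := Γ₁) (Γ₂ := Γ₂) (n := n) (A₁ := A₁) (A₂ := A₂) _ d₁ d₂ =>
      D.comp (splitDup D I.obj Δ Γ₁ Γ₂)
        (D.comp (D.tmap (denC d₁) (denC d₂))
          (D.comp (D.Psi1 (denTy D I.obj (bangN n A₁)) (denTy D I.obj (bangN n A₂)))
            (D.Tmap (m2nD D I.obj n A₁ A₂))))
  | _, _, _, .letv (Δ := Δ) (Γ₁ := Γ₁) (Γ₂ := Γ₂) (x := x) (A := A) _ _ d₁ d₂ =>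
      D.comp (splitDup D I.obj Δ Γ₁ Γ₂)
        (D.comp (D.tmap (denC d₁) (D.id _))
          (D.comp (D.symm _ _)
            (D.comp (D.str (denCtx D I.obj (bangify Δ ++ Γ₂)) (denTy D I.obj A))
              (D.comp (D.Tmap (extHom D I.obj (bangify Δ ++ Γ₂) x A))
                (D.klift (denC d₂))))))
  | _, _, _, .letUnit (Δ := Δ) (Γ₁ := Γ₁) (Γ₂ := Γ₂) _ d₁ d₂ =>
      D.comp (splitDup D I.obj Δ Γ₁ Γ₂)
        (D.comp (D.tmap (denC d₁) (D.id _))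
          (D.comp (D.symm _ _)
            (D.comp (D.str (denCtx D I.obj (bangify Δ ++ Γ₂)) D.unit)
              (D.comp (D.Tmap (D.runit _)) (D.klift (denC d₂))))))
  | _, _, _, .letPair (Δ := Δ) (Γ₁ := Γ₁) (Γ₂ := Γ₂) (n := n) (x₁ := x₁) (A₁ := A₁)
      (x₂ := x₂) (A₂ := A₂) _ _ _ _ d₁ d₂ =>
      D.comp (splitDup D I.obj Δ Γ₁ Γ₂)
        (D.comp (D.tmap (denC d₁) (D.id _))
          (D.comp (D.symm _ _)
            (D.comp (D.str (denCtx D I.obj (bangify Δ ++ Γ₂))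
                (denTy D I.obj (bangN n (Ty.tensor A₁ A₂))))
              (D.comp (D.Tmap (D.comp (D.tmap (D.id _) (m2nDInv D I.obj n A₁ A₂))
                  (ext2Hom D I.obj (bangify Δ ++ Γ₂) x₁ (bangN n A₁) x₂ (bangN n A₂))))
                (D.klift (denC d₂))))))

/-- The value interpretation `⟦π⟧^v : ⟦Γ⟧ → ⟦A⟧` of a typing derivation `π` of
`Γ ⊢ V : A` with `V` a value (Table 5). -/
def denV : ∀ {Γ : CtxL} {M : Tm} {A : Ty}, TypingD cty Γ M A → isValue M = true →
    D.Hom (denCtx D I.obj Γ) (denTy D I.obj A)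
  | _, _, _, .swap (Γ₁ := Γ₁) (Γ₂ := Γ₂) (p := p) (q := q) d, h =>
      D.comp (swapMor D I.obj Γ₁ p q Γ₂) (denV d h)
  | _, _, _, .var (Δ := Δ) (x := x) (A := A) _ s, _ =>
      D.comp (splitCtx D I.obj (bangify Δ) [(x, A)])
        (D.comp (D.tmap (discCtx D I.obj Δ) (D.runit (denTy D I.obj A)))
          (D.comp (D.lunit (denTy D I.obj A)) (Isub D I.obj s)))
  | _, _, _, .cst (Δ := Δ) (c := c) s, _ =>
      D.comp (discCtx D I.obj Δ) (D.comp (I.cst c) (Isub D I.obj s))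
  | _, _, _, .star (Δ := Δ) (n := n), _ =>
      D.comp (discCtx D I.obj Δ) (starMap D I.obj n)
  | _, _, _, .lam0 (Δ := Δ) (x := x) (A := A) _ d, _ =>
      D.PhiInv (D.comp (extHom D I.obj Δ x A) (denC I d))
  | _, _, _, .lamS (Δ := Δ) (n := n) (x := x) (A := A) (B := B) _ d, _ =>
      D.comp (promCtx D I.obj Δ)
        (D.comp (D.Lmap (D.PhiInv (D.comp (extHom D I.obj (bangify Δ) x A) (denC I d))))
          (D.castHom rfl (denTy_bangN D I.obj (n + 1) (Ty.arrow A B)).symm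
            (padL D n (denTy D I.obj (Ty.arrow A B)))))
  | _, _, _, .app _ _ _, h => nomatch h
  | _, _, _, .pair (Δ := Δ) (Γ₁ := Γ₁) (Γ₂ := Γ₂) (n := n) (A₁ := A₁) (A₂ := A₂) _ d₁ d₂, h =>
      D.comp (splitDup D I.obj Δ Γ₁ Γ₂)
        (D.comp (D.tmap (denV d₁ (by simp [isValue] at h; exact h.1))
            (denV d₂ (by simp [isValue] at h; exact h.2)))
          (m2nD D I.obj n A₁ A₂))
  | _, _, _, .letv (Δ := Δ) (Γ₁ := Γ₁) (Γ₂ := Γ₂) (x := x) (A := A) _ _ d₁ d₂, h =>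
      D.comp (splitDup D I.obj Δ Γ₁ Γ₂)
        (D.comp (D.tmap (denV d₁ (by simp [isValue] at h; exact h.1)) (D.id _))
          (D.comp (D.symm _ _)
            (D.comp (extHom D I.obj (bangify Δ ++ Γ₂) x A)
              (denV d₂ (by simp [isValue] at h; exact h.2)))))
  | _, _, _, .letUnit (Δ := Δ) (Γ₁ := Γ₁) (Γ₂ := Γ₂) _ d₁ d₂, h =>
      D.comp (splitDup D I.obj Δ Γ₁ Γ₂)
        (D.comp (D.tmap (denV d₁ (by simp [isValue] at h; exact h.1)) (D.id _))
          (D.comp (D.symm _ _)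
            (D.comp (D.runit _) (denV d₂ (by simp [isValue] at h; exact h.2)))))
  | _, _, _, .letPair (Δ := Δ) (Γ₁ := Γ₁) (Γ₂ := Γ₂) (n := n) (x₁ := x₁) (A₁ := A₁)
      (x₂ := x₂) (A₂ := A₂) _ _ _ _ d₁ d₂, h =>
      D.comp (splitDup D I.obj Δ Γ₁ Γ₂)
        (D.comp (D.tmap (denV d₁ (by simp [isValue] at h; exact h.1)) (D.id _))
          (D.comp (D.symm _ _)
            (D.comp (D.tmap (D.id _) (m2nDInv D I.obj n A₁ A₂))
              (D.comp (ext2Hom D I.obj (bangify Δ ++ Γ₂) x₁ (bangN n A₁) x₂ (bangN n A₂))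
                (denV d₂ (by simp [isValue] at h; exact h.2))))))

end QLamSem

namespace QLamSem

namespace LCDLaws

variable {D : LCDData}

theorem symm_symm_assoc (hD : LCDLaws D) {A B X : D.Obj} (k : D.Hom (D.tens A B) X) :
    D.comp (D.symm A B) (D.comp (D.symm B A) k) = k := by
  rw [← hD.comp_assoc, hD.symm_symm, hD.id_comp]

theorem eta_naturality_assoc (hD : LCDLaws D) {A B X : D.Obj} (f : D.Hom A B)
    (k : D.Hom (D.T B) X) :
    D.comp (D.eta A) (D.comp (D.Tmap f) k) = D.comp f (D.comp (D.eta B) k) := by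
  rw [← hD.comp_assoc, ← hD.eta_natural, hD.comp_assoc]

theorem eta_klift (hD : LCDLaws D) {A B : D.Obj} (f : D.Hom A (D.T B)) :
    D.comp (D.eta A) (D.klift f) = f := by
  rw [LCDData.klift, hD.eta_naturality_assoc, hD.mu_unit_left, hD.comp_id]

theorem tmap_eta_symm (hD : LCDLaws D) (A B : D.Obj) :
    D.comp (D.tmap (D.eta A) (D.id B)) (D.comp (D.symm (D.T A) B) (D.str B A))
      = D.comp (D.symm A B) (D.eta (D.tens B A)) := by
  rw [← hD.comp_assoc, hD.symm_natural, hD.comp_assoc, hD.str_eta]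

theorem tmap_comp_eta_symm_str (hD : LCDLaws D) {X A B Y : D.Obj} (v : D.Hom X A)
    (k : D.Hom (D.T (D.tens B A)) Y) :
    D.comp (D.tmap (D.comp v (D.eta A)) (D.id B))
        (D.comp (D.symm (D.T A) B) (D.comp (D.str B A) k))
      = D.comp (D.tmap v (D.id B)) (D.comp (D.symm A B) (D.comp (D.eta (D.tens B A)) k)) := by
  have h : D.tmap (D.comp v (D.eta A)) (D.id B)
      = D.comp (D.tmap v (D.id B)) (D.tmap (D.eta A) (D.id B)) := by
    rw [← hD.tmap_comp, hD.id_comp]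
  rw [h, hD.comp_assoc, ← hD.comp_assoc (D.symm (D.T A) B),
    ← hD.comp_assoc (D.tmap (D.eta A) (D.id B)), hD.tmap_eta_symm, hD.comp_assoc]

theorem tmap_comp_eta_let (hD : LCDLaws D) {X A B C E : D.Obj} (v : D.Hom X A)
    (f : D.Hom (D.tens B A) C) (w : D.Hom C E) :
    D.comp (D.tmap (D.comp v (D.eta A)) (D.id B))
        (D.comp (D.symm (D.T A) B)
          (D.comp (D.str B A) (D.comp (D.Tmap f) (D.klift (D.comp w (D.eta E))))))
      = D.comp (D.tmap v (D.id B)) (D.comp (D.symm A B) (D.comp f (D.comp w (D.eta E)))) := by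
  rw [hD.tmap_comp_eta_symm_str, hD.eta_naturality_assoc, hD.eta_klift]

theorem tmap_eta_Psi1 (hD : LCDLaws D) (A B : D.Obj) :
    D.comp (D.tmap (D.eta A) (D.eta B)) (D.Psi1 A B) = D.eta (D.tens A B) := by
  have h : D.tmap (D.eta A) (D.eta B)
      = D.comp (D.tmap (D.id A) (D.eta B)) (D.tmap (D.comp (D.id A) (D.eta A)) (D.id (D.T B))) := by
    rw [← hD.tmap_comp, hD.id_comp, hD.id_comp, hD.comp_id]
  rw [LCDData.Psi1, h, hD.comp_assoc, hD.tmap_comp_eta_symm_str, hD.eta_klift, hD.tmap_id,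
    hD.id_comp, hD.symm_symm_assoc, hD.str_eta]

theorem tmap_comp_eta_Psi1 (hD : LCDLaws D) {X Y A B Z : D.Obj} (v : D.Hom X A)
    (w : D.Hom Y B) (k : D.Hom (D.T (D.tens A B)) Z) :
    D.comp (D.tmap (D.comp v (D.eta A)) (D.comp w (D.eta B))) (D.comp (D.Psi1 A B) k)
      = D.comp (D.tmap v w) (D.comp (D.eta (D.tens A B)) k) := by
  rw [hD.tmap_comp, hD.comp_assoc, ← hD.comp_assoc _ (D.Psi1 A B), hD.tmap_eta_Psi1]

end LCDLaws

/-- **Statement 14.** If `Δ ⊢ V : A` is a valid typing judgment with `V` a value, then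
the computational denotation factors through the unit of the monad:
`⟦Δ ⊢ V : A⟧^c = ⟦Δ ⊢ V : A⟧^v ; η_{⟦A⟧} : ⟦Δ⟧ → T ⟦A⟧`. -/
theorem value_denotation_factors_through_unit
    (D : LCDData) (hD : LCDLaws D) (cty : ℕ → Ty) (I : Interp D cty)
    {Δ : CtxL} {V : Tm} {A : Ty} (π : TypingD cty Δ V A) (hV : isValue V = true) :
    denC I π = D.comp (denV I π hV) (D.eta (denTy D I.obj A)) := by
  induction π with
  | swap d ih => simp only [denC, denV, ih hV, hD.comp_assoc]
  | var _ s => simp only [denC, denV, hD.comp_assoc]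
  | cst s => simp only [denC, denV, hD.comp_assoc]
  | star => simp only [denC, denV, hD.comp_assoc]
  | lam0 _ d _ => rfl
  | lamS _ d _ => simp only [denC, denV, hD.comp_assoc]
  | app _ _ _ _ _ => cases hV
  | pair _ d₁ d₂ ih₁ ih₂ =>
    have h := hV
    simp only [isValue, Bool.and_eq_true] at h
    simp only [denC, denV, ih₁ h.1, ih₂ h.2, hD.comp_assoc]
    rw [hD.tmap_comp_eta_Psi1, ← hD.eta_natural]
  | letv _ _ d₁ d₂ ih₁ ih₂ =>
    have h := hV
    simp only [isValue, Bool.and_eq_true] at h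
    simp only [denC, denV, ih₁ h.1, ih₂ h.2, hD.comp_assoc, hD.tmap_comp_eta_let]
  | letUnit _ d₁ d₂ ih₁ ih₂ =>
    have h := hV
    simp only [isValue, Bool.and_eq_true] at h
    simp only [denC, denV, ih₁ h.1, ih₂ h.2, hD.comp_assoc]
    refine congrArg _ ((hD.tmap_comp_eta_let (denV I d₁ h.1) (D.runit _) (denV I d₂ h.2)).trans ?_)
    exact congrArg _ (congrArg _ (hD.comp_assoc (D.runit _) _ _).symm)
  | letPair _ _ _ _ d₁ d₂ ih₁ ih₂ =>
    have h := hV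
    simp only [isValue, Bool.and_eq_true] at h
    simp only [denC, denV, ih₁ h.1, ih₂ h.2, hD.comp_assoc, hD.tmap_comp_eta_let]

end QLamSem
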